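/- (Theorem C, conclusion) Assume R is not Gorenstein (equivalently, r ≥ 2), and let A be a non-zero minimal acyclic complex of finitely generated free R-modules. Set H = {i ∈ ℤ : H_i(A*) = 0}. If at least two out of every three consecutive integers belong to H (i.e., for every l ∈ ℤ at least two of l, l+1, l+2 lie in H), then H = ℤ; that is, A is totally acyclic. -/

import Mathlib

open IsLocalRing CategoryTheory

/-- The length of an `R`-module `M`: the supremum of the lengths of strictly increasing
chains of submodules of `M`.  For a module annihilated by the maximal ideal of a local
ring this coincides with the dimension over the residue field `k`. -/
noncomputable def moduleLength (R M : Type) [Ring R] [AddCommGroup M] [Module R M] : ℕ∞ :=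
  ⨆ p : LTSeries (Submodule R M), (p.length : ℕ∞)

/-- `Ext^n_R(M, N)`, as an object of `ModuleCat R`. -/
noncomputable def extModule (R : Type) [CommRing R] (M N : Type) [AddCommGroup M] [Module R M]
    [AddCommGroup N] [Module R N] (n : ℕ) : ModuleCat R :=
  ((Ext R (ModuleCat R) n).obj (Opposite.op (ModuleCat.of R M))).obj (ModuleCat.of R N)

/-- The `i`-th Betti number `β_i^R(M) = dim_k Ext^i_R(M, k)` of a module `M` over a local
ring `(R, m, k)`, computed as the length over `R` of `Ext^i_R(M, k)` (an `R`-module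
annihilated by `m`, hence a `k`-vector space). -/
noncomputable def bettiNum (R : Type) [CommRing R] [IsLocalRing R] (M : Type) [AddCommGroup M]
    [Module R M] (i : ℕ) : ℕ∞ :=
  moduleLength R (extModule R M (ResidueField R) i).carrier

/-- The `i`-th Bass number `μ^i_R = dim_k Ext^i_R(k, R)` of a local ring `(R, m, k)`. -/
noncomputable def bassNum (R : Type) [CommRing R] [IsLocalRing R] (i : ℕ) : ℕ∞ :=
  moduleLength R (extModule R (ResidueField R) R i).carrier

/-- The socle `Soc R = (0 :_R m)` of a local ring `(R, m)`. -/
noncomputable def socle (R : Type) [CommRing R] [IsLocalRing R] : Ideal R :=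
  Submodule.colon (⊥ : Ideal R) (maximalIdeal R)

/-- The socle dimension `r = dim_k (0 :_R m)` of a local ring `(R, m, k)`. -/
noncomputable def socdim (R : Type) [CommRing R] [IsLocalRing R] : ℕ∞ :=
  moduleLength R (socle R)

/-- The embedding dimension `e = dim_k (m/m²)` of a local ring `(R, m, k)`. -/
noncomputable def embdim (R : Type) [CommRing R] [IsLocalRing R] : ℕ∞ :=
  moduleLength R (CotangentSpace R)

/-- The residue field `k` is (isomorphic to) a direct summand of the `R`-module `M`,
expressed by a split injection `k → M`. -/
def kSummand (R : Type) [CommRing R] [IsLocalRing R] (M : Type) [AddCommGroup M]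
    [Module R M] : Prop :=
  ∃ (f : M →ₗ[R] ResidueField R) (g : ResidueField R →ₗ[R] M), f ∘ₗ g = LinearMap.id

/-- Vanishing of the `i`-th homology of the dual complex `A* = Hom_R(A, R)` of a chain
complex `A` with differentials `d i : A (i+1) → A i` (so that `∂_j = d (j-1)`):
every functional on `A_i` vanishing on the image of `∂_{i+1}` factors through `∂_i`.
(The index `i` is written as `i - 1 + 1` for type-checking reasons.)  Together with the
automatic inclusion `im ∂*_i ⊆ ker ∂*_{i+1}`, this says exactly `H_i(A*) = 0`. -/
def dualHomologyIsZero (R : Type) [CommRing R] (A : ℤ → Type) [∀ i, AddCommGroup (A i)]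
    [∀ i, Module R (A i)] (d : ∀ i : ℤ, A (i + 1) →ₗ[R] A i) (i : ℤ) : Prop :=
  ∀ f : A (i - 1 + 1) →ₗ[R] R, f ∘ₗ d (i - 1 + 1) = 0 →
    ∃ g : A (i - 1) →ₗ[R] R, f = g ∘ₗ d (i - 1)


section helpers
variable {R : Type} [CommRing R]

lemma moduleLength_eq (M : Type) [AddCommGroup M] [Module R M] :
    moduleLength R M = Module.length R M := by
  apply WithBot.coe_injective
  rw [Module.coe_length, Order.krullDim_eq_iSup_length]
  rfl

/-- Length of a submodule as a natural number. -/
noncomputable def lenN {M : Type} [AddCommGroup M] [Module R M] (N : Submodule R M) : ℕ :=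
  (Module.length R N).toNat

lemma mem_smul_top_basis {A ι : Type} [AddCommGroup A] [Module R A] [Fintype ι]
    (b : Module.Basis ι R A) (I : Ideal R) (x : A) :
    x ∈ I • (⊤ : Submodule R A) ↔ ∀ i, b.repr x i ∈ I := by
  constructor
  · intro hx i
    refine Submodule.smul_induction_on hx ?_ ?_
    · intro s hs a _
      simpa using I.mul_mem_right _ hs
    · intro x y hx hy
      simpa using I.add_mem hx hy
  · intro h
    rw [← b.sum_repr x]
    exact Submodule.sum_mem _ fun i _ => Submodule.smul_mem_smul (h i) trivial

lemma apply_mem_of_mem_smul_top {A : Type} [AddCommGroup A] [Module R A]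
    {I : Ideal R} {x : A} (hx : x ∈ I • (⊤ : Submodule R A)) (φ : A →ₗ[R] R) : φ x ∈ I := by
  refine Submodule.smul_induction_on hx ?_ ?_
  · intro s hs a _
    simpa using I.mul_mem_right _ hs
  · intro x y hx hy
    simpa using I.add_mem hx hy

variable {A B C : Type} [AddCommGroup A] [Module R A] [AddCommGroup B] [Module R B]
  [AddCommGroup C] [Module R C]

lemma length_smul_top [Module.Free R A] [Module.Finite R A] [Nontrivial R] (I : Ideal R) :
    Module.length R (I • (⊤ : Submodule R A) : Submodule R A) =
      Module.finrank R A * Module.length R I := by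
  let b := Module.finBasis R A
  let F : (I • (⊤ : Submodule R A) : Submodule R A) →ₗ[R] (Fin (Module.finrank R A) → I) :=
    LinearMap.pi fun i => ((b.coord i).comp (Submodule.subtype _)).codRestrict I
      (fun x => apply_mem_of_mem_smul_top x.2 (b.coord i))
  have hF : Function.Bijective F := by
    constructor
    · intro x y hxy
      apply Subtype.ext
      apply b.repr.injective
      ext i
      exact congrArg (fun z => ((z i : I) : R)) hxy
    · intro v
      refine ⟨⟨∑ i, (v i : R) • b i, Submodule.sum_mem _ fun i _ =>
        Submodule.smul_mem_smul (v i).2 trivial⟩, ?_⟩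
      ext i
      change b.repr (∑ i, (v i : R) • b i) i = v i
      rw [b.repr_sum_self]
  rw [(LinearEquiv.ofBijective F hF).length_eq, Module.length_pi_of_fintype]
  simp

variable [IsArtinianRing R]

lemma lenN_coe [Module.Finite R A] (N : Submodule R A) : (lenN N : ℕ∞) = Module.length R N := by
  have : IsNoetherian R A := inferInstance
  have : IsArtinian R A := inferInstance
  exact ENat.natCast_toNat Module.length_ne_top

lemma lenN_mono [Module.Finite R A] {N K : Submodule R A} (h : N ≤ K) : lenN N ≤ lenN K := by
  have := Module.length_le_of_injective (Submodule.inclusion h) (Submodule.inclusion_injective h)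
  rw [← lenN_coe, ← lenN_coe] at this
  exact_mod_cast this

lemma lenN_smul_top [Module.Free R A] [Module.Finite R A] [Nontrivial R] (I : Ideal R) :
    lenN (I • (⊤ : Submodule R A)) = Module.finrank R A * lenN I := by
  have := length_smul_top (A := A) I
  rw [← lenN_coe, ← lenN_coe] at this
  exact_mod_cast this

lemma lenN_map [Module.Finite R A] [Module.Finite R B] (f : A →ₗ[R] B) (N : Submodule R A)
    (h : LinearMap.ker f ≤ N) : lenN N = lenN (LinearMap.ker f) + lenN (N.map f) := by
  have := Module.length_eq_add_of_exact (Submodule.inclusion h) (f.submoduleMap N)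
    (Submodule.inclusion_injective h) (f.submoduleMap_surjective N) (by
      intro x
      constructor
      · intro hx
        have : f x = 0 := congrArg Subtype.val hx
        exact ⟨⟨x, this⟩, rfl⟩
      · rintro ⟨y, rfl⟩
        exact Subtype.ext y.2)
  rw [← lenN_coe, ← lenN_coe, ← lenN_coe] at this
  exact_mod_cast this

lemma lenN_eq_of_le [Module.Finite R A] {N K : Submodule R A} (h : N ≤ K)
    (hl : lenN K ≤ lenN N) : N = K := by
  by_contra hne
  have hlt : N < K := lt_of_le_of_ne h hne
  have : IsNoetherian R A := inferInstance
  have : IsArtinian R A := inferInstance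
  have h1 := Submodule.height_strictMono hlt
  rw [← Module.length_submodule, ← Module.length_submodule, ← lenN_coe, ← lenN_coe] at h1
  have h1 : lenN N < lenN K := by exact_mod_cast h1
  omega

lemma lenN_lt [Module.Finite R A] {N K : Submodule R A} (h : N < K) : lenN N < lenN K := by
  by_contra hh
  exact h.ne (lenN_eq_of_le h.le (by omega))

variable [IsLocalRing R]

lemma lenN_range_aux [Module.Free R A] [Module.Finite R A] [Module.Finite R B] (f : A →ₗ[R] B)
    (hk : LinearMap.ker f ≤ maximalIdeal R • ⊤) :
    Module.finrank R A * lenN (⊤ : Ideal R) = lenN (LinearMap.ker f) + lenN (LinearMap.range f) ∧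
    Module.finrank R A * lenN (maximalIdeal R) =
      lenN (LinearMap.ker f) + lenN (maximalIdeal R • LinearMap.range f) := by
  constructor
  · rw [← lenN_smul_top, lenN_map f _ (by simp)]
    simp
  · rw [← lenN_smul_top, lenN_map f _ hk, Submodule.map_smul'', LinearMap.range_eq_map]

set_option linter.unusedSectionVars false

lemma mul_eq_zero_of_socle {s x : R} (hs : s ∈ socle R) (hx : x ∈ maximalIdeal R) : s * x = 0 := by
  have := Submodule.mem_colon.1 hs x hx
  simpa using this

/-- `S A` is in the kernel of any map with image in `m B`. -/
lemma socle_le_ker (g : A →ₗ[R] B) (hg : LinearMap.range g ≤ maximalIdeal R • ⊤) :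
    socle R • (⊤ : Submodule R A) ≤ LinearMap.ker g := by
  rw [Submodule.smul_le]
  intro s hs a _
  have h1 : g a ∈ maximalIdeal R • (⊤ : Submodule R B) := hg ⟨a, rfl⟩
  rw [LinearMap.mem_ker, map_smul]
  refine Submodule.smul_induction_on h1 ?_ ?_
  · intro x hx b _
    rw [smul_smul, mul_eq_zero_of_socle hs hx, zero_smul]
  · intro x y hx hy
    rw [smul_add, hx, hy, add_zero]

lemma smul_range_le_socle (h3 : maximalIdeal R ^ 3 = ⊥) (f : A →ₗ[R] B)
    (hf : LinearMap.range f ≤ maximalIdeal R • ⊤) :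
    maximalIdeal R • LinearMap.range f ≤ socle R • (⊤ : Submodule R B) := by
  have hm : maximalIdeal R * maximalIdeal R ≤ socle R := by
    intro x hx
    refine Submodule.mem_colon.2 fun y hy => ?_
    have : x * y ∈ maximalIdeal R ^ 3 := by
      rw [pow_succ, pow_two]
      exact Ideal.mul_mem_mul hx hy
    rw [h3] at this
    exact this
  calc _ ≤ maximalIdeal R • (maximalIdeal R • (⊤ : Submodule R B)) := Submodule.smul_mono le_rfl hf
    _ = (maximalIdeal R * maximalIdeal R) • (⊤ : Submodule R B) := by
        rw [← smul_eq_mul, Submodule.smul_assoc]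
    _ ≤ _ := Submodule.smul_mono_left hm

lemma exists_functional [Module.Free R A] [Module.Finite R A] {u : A}
    (hu : u ∉ maximalIdeal R • (⊤ : Submodule R A)) : ∃ φ : A →ₗ[R] R, φ u = 1 := by
  let b := Module.finBasis R A
  rw [mem_smul_top_basis b] at hu
  push Not at hu
  obtain ⟨i, hi⟩ := hu
  have : IsUnit (b.repr u i) := by simpa using hi
  obtain ⟨c, hc⟩ := this.exists_left_inv
  exact ⟨c • b.coord i, by simpa using hc⟩

lemma exists_one_of_not_mem [Module.Free R A] [Module.Finite R A] {ψ : Module.Dual R A}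
    (hu : ψ ∉ maximalIdeal R • (⊤ : Submodule R (Module.Dual R A))) : ∃ a : A, ψ a = 1 := by
  let b := Module.finBasis R A
  rw [mem_smul_top_basis b.dualBasis] at hu
  push Not at hu
  obtain ⟨i, hi⟩ := hu
  have : IsUnit (ψ (b i)) := by simpa using hi
  obtain ⟨c, hc⟩ := this.exists_left_inv
  exact ⟨c • b i, by simpa using hc⟩

lemma exists_socle (hr : 2 ≤ socdim R) :
    ∃ σ ∈ socle R, σ ≠ 0 ∧ ∃ τ ∈ socle R, ¬ ∃ c, τ = σ * c := by
  by_contra hcon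
  push Not at hcon
  rw [socdim, moduleLength_eq] at hr
  have : Nontrivial (socle R) := by
    rw [← Module.length_pos_iff (R := R)]
    exact lt_of_lt_of_le (by norm_num) hr
  have hs : IsSimpleModule R (socle R) := by
    rw [isSimpleModule_iff]
    refine { eq_bot_or_eq_top := fun N => ?_ }
    by_cases h : N = ⊥
    · exact Or.inl h
    · right
      obtain ⟨σ, hσ, h0⟩ := N.exists_mem_ne_zero_of_ne_bot h
      rw [eq_top_iff]
      intro τ _
      obtain ⟨c, hc⟩ := hcon σ σ.2 (fun h => h0 (Subtype.ext h)) τ τ.2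
      have : τ = c • σ := by
        apply Subtype.ext
        simp [hc, mul_comm]
      rw [this]
      exact N.smul_mem _ hσ
  rw [Module.length_eq_one] at hr
  exact absurd hr (by norm_num)

/-- Key lemma: if functionals on `A` killing `im e = ker f` factor through `f`, then
`Soc B ⊆ m (im f)`. -/
lemma socle_le_smul_range [Module.Free R A] [Module.Finite R A]
    [Module.Free R B] [Module.Finite R B] (hr : 2 ≤ socdim R)
    (f : A →ₗ[R] B) (hk : LinearMap.ker f ≤ maximalIdeal R • ⊤)
    (hS : socle R • (⊤ : Submodule R B) ≤ LinearMap.range f)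
    (H : ∀ φ : A →ₗ[R] R, LinearMap.ker f ≤ LinearMap.ker φ → ∃ ψ : B →ₗ[R] R, φ = ψ ∘ₗ f) :
    socle R • (⊤ : Submodule R B) ≤ maximalIdeal R • LinearMap.range f := by
  intro x hx
  by_contra hxn
  obtain ⟨σ, hσ, hσ0, τ, hτ, hn⟩ := exists_socle hr
  obtain ⟨u, rfl⟩ := hS hx
  have hu : u ∉ maximalIdeal R • (⊤ : Submodule R A) := by
    intro hu
    apply hxn
    rw [LinearMap.range_eq_map, ← Submodule.map_smul'']
    exact ⟨u, hu, rfl⟩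
  obtain ⟨φ, hφ⟩ := exists_functional hu
  obtain ⟨ψ, hψ⟩ := H (σ • φ) (by
    intro v hv
    have := apply_mem_of_mem_smul_top (hk hv) φ
    simpa using mul_eq_zero_of_socle hσ this)
  have hψ' : ∀ v, σ * φ v = ψ (f v) := fun v => by
    simpa using LinearMap.congr_fun hψ v
  have hnot : ψ ∉ maximalIdeal R • (⊤ : Submodule R (Module.Dual R B)) := by
    intro hmem
    apply hσ0
    have h1 : ψ (f u) = 0 := by
      have hev := socle_le_ker ψ (by
        rintro _ ⟨b, rfl⟩
        have := apply_mem_of_mem_smul_top hmem (Module.Dual.eval R B b)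
        simpa using this) hx
      exact hev
    rw [← hψ', hφ, mul_one] at h1
    exact h1
  obtain ⟨b, hb⟩ := exists_one_of_not_mem hnot
  obtain ⟨v, hv⟩ := hS (Submodule.smul_mem_smul hτ (trivial : b ∈ (⊤ : Submodule R B)))
  apply hn
  refine ⟨φ v, ?_⟩
  rw [hψ', hv, map_smul, hb, smul_eq_mul, mul_one]

lemma ker_dual_le [Module.Free R B] [Module.Finite R B] (hr : 2 ≤ socdim R)
    (f : A →ₗ[R] B) (hS : socle R • (⊤ : Submodule R B) ≤ LinearMap.range f) :
    LinearMap.ker f.dualMap ≤ maximalIdeal R • ⊤ := by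
  obtain ⟨σ, hσ, hσ0, -⟩ := exists_socle hr
  intro ψ hψ
  by_contra hn
  obtain ⟨b, hb⟩ := exists_one_of_not_mem hn
  obtain ⟨v, hv⟩ := hS (Submodule.smul_mem_smul hσ (trivial : b ∈ (⊤ : Submodule R B)))
  apply hσ0
  have : ψ (f v) = 0 := LinearMap.congr_fun (LinearMap.mem_ker.1 hψ) v
  rw [hv, map_smul, hb] at this
  simpa using this

lemma range_dual_le [Module.Free R A] [Module.Finite R A]
    (f : A →ₗ[R] B) (hf : LinearMap.range f ≤ maximalIdeal R • ⊤) :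
    LinearMap.range f.dualMap ≤ maximalIdeal R • ⊤ := by
  rintro _ ⟨ψ, rfl⟩
  rw [mem_smul_top_basis (Module.finBasis R A).dualBasis]
  intro i
  simpa using apply_mem_of_mem_smul_top (hf ⟨_, rfl⟩) ψ

lemma socle_le_smul_range_dual [Module.Free R A] [Module.Finite R A]
    [Module.Free R B] [Module.Finite R B] (hr : 2 ≤ socdim R)
    (f : A →ₗ[R] B)
    (hS : socle R • (⊤ : Submodule R B) ≤ maximalIdeal R • LinearMap.range f)
    (H : socle R • (⊤ : Submodule R (Module.Dual R A)) ≤ LinearMap.range f.dualMap) :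
    socle R • (⊤ : Submodule R (Module.Dual R A)) ≤
      maximalIdeal R • LinearMap.range f.dualMap := by
  obtain ⟨σ, hσ, hσ0, -⟩ := exists_socle hr
  intro θ hθ
  obtain ⟨ψ, rfl⟩ := H hθ
  by_cases hn : ψ ∈ maximalIdeal R • (⊤ : Submodule R (Module.Dual R B))
  · rw [LinearMap.range_eq_map, ← Submodule.map_smul'']
    exact ⟨ψ, hn, rfl⟩
  exfalso
  obtain ⟨b, hb⟩ := exists_one_of_not_mem hn
  apply hσ0
  have h1 : maximalIdeal R • LinearMap.range f ≤ LinearMap.ker ψ := by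
    rw [Submodule.smul_le]
    rintro x hx _ ⟨v, rfl⟩
    have := apply_mem_of_mem_smul_top hθ (Module.Dual.eval R A v)
    have := mul_eq_zero_of_socle this hx
    rw [LinearMap.mem_ker, map_smul, smul_eq_mul, mul_comm]
    simpa using this
  have := h1 (hS (Submodule.smul_mem_smul hσ (Submodule.mem_top (x := b))))
  rw [LinearMap.mem_ker, map_smul, hb] at this
  simpa using this

end helpers

set_option maxHeartbeats 2000000 in
lemma arith_aux (e r w x y z : ℤ) (he : 1 ≤ e) (hr : 2 ≤ r) (hw : 0 ≤ w) (hx : 0 ≤ x)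
    (hy : 0 ≤ y) (hz : 0 ≤ z) (h1 : (1 + r) * x = e * w) (h2 : (1 + r) * y = e * z)
    (h3 : (e + 1) * y - z = (e + r) * x - r * w) (h4 : e * y - z ≤ r * x)
    (h5 : (1 + e) * x - w ≤ (e + r) * y - r * z) :
    (1 + e) * x - w = (e + r) * y - r * z := by
  obtain ⟨P, hP⟩ : ∃ P, P = e * (e + 1) - (1 + r) := ⟨_, rfl⟩
  obtain ⟨Q, hQ⟩ : ∃ Q, Q = e * (e + r) - r * (1 + r) := ⟨_, rfl⟩
  have hQP : Q - P = (r - 1) * (e - 1 - r) := by rw [hP, hQ]; ring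
  have a1 : P * y = Q * x := by rw [hP, hQ]; linear_combination e * h3 - h2 + r * h1
  have a2 : P * x ≤ Q * y := by
    have := mul_le_mul_of_nonneg_left h5 (by omega : 0 ≤ e)
    rw [hP, hQ]; nlinarith
  have a3 : (e * e - (1 + r)) * y ≤ e * r * x := by
    have := mul_le_mul_of_nonneg_left h4 (by omega : 0 ≤ e)
    nlinarith
  have fin : x = 0 → y = 0 → (1 + e) * x - w = (e + r) * y - r * z := by
    intro hx hy
    subst hx hy
    have hw : w = 0 := by
      rcases mul_eq_zero.1 (show e * w = 0 by linarith) with h | h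
      · omega
      · exact h
    have hz : z = 0 := by
      rcases mul_eq_zero.1 (show e * z = 0 by linarith) with h | h
      · omega
      · exact h
    simp [hw, hz]
  rcases lt_trichotomy e (1 + r) with h | h | h
  · have hlt : Q < P := by nlinarith
    rcases le_or_gt P 0 with hp | hp
    · have hx0 : x = 0 := by
        by_contra hne
        have hx' : 0 < x := by omega
        have hq : Q < 0 := by omega
        have e1 : Q * Q * x = P * (Q * y) := by linear_combination (-Q) * a1
        have e2 : P * (Q * y) ≤ P * (P * x) := mul_le_mul_of_nonpos_left a2 hp
        have e3 : P * P < Q * Q := by nlinarith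
        nlinarith
      apply fin hx0
      subst hx0
      have : Q * y ≥ 0 := by linarith
      nlinarith
    · rcases le_or_gt Q 0 with hq | hq
      · have hy0 : y = 0 := by nlinarith [mul_nonneg (neg_nonneg.2 hq) hx]
        subst hy0
        refine fin ?_ rfl
        nlinarith
      · have hx0 : x = 0 := by
          by_contra hne
          have hx' : 0 < x := by omega
          have e1 : Q * Q * x = P * (Q * y) := by linear_combination (-Q) * a1
          have e2 : P * (P * x) ≤ P * (Q * y) := mul_le_mul_of_nonneg_left a2 hp.le
          have e3 : Q * Q < P * P := by nlinarith
          nlinarith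
        apply fin hx0
        subst hx0
        nlinarith
  · have hp : P = e * e := by rw [hP, h]; ring
    have hq : Q = e * e := by linear_combination hQP + hp + (r - 1) * h
    rw [hp, hq] at a1
    have hxy : y = x := mul_left_cancel₀ (by positivity) a1
    subst hxy
    have hwx : w = y := mul_left_cancel₀ (by omega : e ≠ 0) (by rw [← h1, ← h])
    have hzx : z = y := mul_left_cancel₀ (by omega : e ≠ 0) (by rw [← h2, ← h])
    subst hwx
    subst hzx
    ring
  · have hp : 0 < P := by nlinarith
    have hq : 0 < Q := by nlinarith
    have e1 : (e * e - (1 + r)) * Q * x ≤ e * r * P * x := by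
      have := mul_le_mul_of_nonneg_left a3 hp.le
      have h6 : P * ((e * e - (1 + r)) * y) = (e * e - (1 + r)) * Q * x := by
        linear_combination (e * e - (1 + r)) * a1
      rw [← h6]; linarith
    have e2 : e * r * P < (e * e - (1 + r)) * Q := by
      obtain ⟨k, hk⟩ : ∃ k, k = e - 2 - r := ⟨_, rfl⟩
      obtain rfl : e = k + 2 + r := by omega
      have hk0 : 0 ≤ k := by omega
      obtain ⟨t, rfl⟩ : ∃ t, r = t + 2 := ⟨r - 2, by ring⟩
      have ht : 0 ≤ t := by omega
      rw [hP, hQ, ← sub_pos]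
      ring_nf
      positivity
    have hx0 : x = 0 := by
      by_contra hne
      have hx' : 0 < x := by omega
      have := mul_lt_mul_of_pos_right e2 hx'
      linarith
    apply fin hx0
    rw [hx0, mul_zero] at a1
    exact (mul_eq_zero.1 a1).resolve_left (ne_of_gt hp)
/-- Theorem C, conclusion: let `(R, m, k)` be a local ring with `m³ = 0 ≠ m²` which is
not Gorenstein (equivalently, `r ≥ 2`), and let `A` be a non-zero minimal acyclic
complex of finitely generated free `R`-modules.  If for every `l` at least two of
`l, l+1, l+2` lie in `H = {i : H_i(A*) = 0}`, then `H = ℤ`, i.e. `A` is totally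
acyclic. -/
theorem theorem_C (R : Type) [CommRing R] [IsNoetherianRing R] [IsLocalRing R]
    (h3 : maximalIdeal R ^ 3 = ⊥) (h2 : maximalIdeal R ^ 2 ≠ ⊥)
    (hnotGor : 2 ≤ socdim R)
    (A : ℤ → Type) [∀ i, AddCommGroup (A i)] [∀ i, Module R (A i)]
    (hfree : ∀ i, Module.Free R (A i)) (hfin : ∀ i, Module.Finite R (A i))
    (d : ∀ i : ℤ, A (i + 1) →ₗ[R] A i)
    (hcx : ∀ i, d i ∘ₗ d (i + 1) = 0)
    (hacyclic : ∀ i, LinearMap.range (d (i + 1)) = LinearMap.ker (d i))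
    (hmin : ∀ i, LinearMap.range (d i) ≤ maximalIdeal R • (⊤ : Submodule R (A i)))
    (hnz : ∃ i, Nontrivial (A i))
    (htwo : ∀ l : ℤ,
      (dualHomologyIsZero R A d l ∧ dualHomologyIsZero R A d (l + 1)) ∨
      (dualHomologyIsZero R A d l ∧ dualHomologyIsZero R A d (l + 2)) ∨
      (dualHomologyIsZero R A d (l + 1) ∧ dualHomologyIsZero R A d (l + 2))) :
    ∀ i : ℤ, dualHomologyIsZero R A d i := by
  have hart : IsArtinianRing R :=
    (isArtinianRing_iff_isNilpotent_maximalIdeal R).2 ⟨3, h3⟩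
  let P : ℤ → Prop := fun n => ∀ f : A (n + 1) →ₗ[R] R, f ∘ₗ d (n + 1) = 0 →
    ∃ g : A n →ₗ[R] R, f = g ∘ₗ d n
  suffices hP : ∀ n, P n from fun i => hP (i - 1)
  have hS : ∀ n, socle R • (⊤ : Submodule R (A n)) ≤ LinearMap.range (d n) := by
    intro n
    obtain ⟨p, rfl⟩ : ∃ p, n = p + 1 := ⟨n - 1, by ring⟩
    rw [hacyclic]
    exact socle_le_ker _ (hmin p)
  have hk : ∀ n, LinearMap.ker (d n) ≤ maximalIdeal R • ⊤ := fun n => by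
    rw [← hacyclic]
    exact hmin (n + 1)
  let a : ℤ → ℕ := fun n => Module.finrank R (A n)
  let M : ℤ → ℕ := fun n => lenN (LinearMap.range (d n))
  let c : ℤ → ℕ := fun n => lenN (maximalIdeal R • LinearMap.range (d n))
  let κ : ℤ → ℕ := fun n => lenN (LinearMap.ker (d n).dualMap)
  let ν : ℤ → ℕ := fun n => lenN (LinearMap.range (d n).dualMap)
  let ι : ℤ → ℕ := fun n => lenN (maximalIdeal R • LinearMap.range (d n).dualMap)
  obtain ⟨L, hL⟩ : ∃ L, L = lenN (⊤ : Ideal R) := ⟨_, rfl⟩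
  obtain ⟨q, hq⟩ : ∃ q, q = lenN (maximalIdeal R) := ⟨_, rfl⟩
  obtain ⟨r, hr⟩ : ∃ r, r = lenN (socle R) := ⟨_, rfl⟩
  have hr2 : 2 ≤ r := by
    have h := hnotGor
    rw [socdim, moduleLength_eq, ← lenN_coe, ← hr] at h
    exact_mod_cast h
  have hLq : L = q + 1 := by
    have h := (Submodule.range_mkQ (maximalIdeal R))
    have h2 := lenN_map (maximalIdeal R).mkQ ⊤ le_top
    rw [Submodule.ker_mkQ, ← hL, ← hq] at h2
    rw [h2]
    congr 1
    rw [Submodule.map_top, h]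
    have h4 : (lenN (⊤ : Submodule R (R ⧸ maximalIdeal R)) : ℕ∞) = 1 := by
      have : IsSimpleModule R (R ⧸ maximalIdeal R) :=
        isSimpleModule_iff_isCoatom.2 (maximalIdeal.isMaximal R).out
      rw [lenN_coe, Module.length_top, Module.length_eq_one]
    exact_mod_cast h4
  have hrq : r < q := by
    rw [hr, hq]
    apply lenN_lt
    refine lt_of_le_of_ne ?_ ?_
    · apply IsLocalRing.le_maximalIdeal
      intro h
      apply h2
      have h1 : (1 : R) ∈ socle R := by rw [h]; trivial
      have : maximalIdeal R = ⊥ := by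
        rw [eq_bot_iff]
        intro x hx
        simpa using mul_eq_zero_of_socle h1 hx
      rw [this]
      simp
    · intro h
      apply h2
      rw [eq_bot_iff, pow_two, Ideal.mul_le]
      intro x hx y hy
      exact mul_eq_zero_of_socle (by rwa [h]) hy
  have e1 : ∀ n, a (n + 1) * L = M (n + 1) + M n := by
    intro n
    have := (lenN_range_aux (d n) (hk n)).1
    rw [← hacyclic, ← hL] at this
    exact this
  have e2 : ∀ n, a (n + 1) * q = M (n + 1) + c n := by
    intro n
    have := (lenN_range_aux (d n) (hk n)).2
    rw [← hacyclic, ← hq] at this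
    exact this
  have e3 : ∀ n, c n ≤ a n * r := by
    intro n
    have := lenN_mono (smul_range_le_socle h3 (d n) (hmin n))
    rw [lenN_smul_top, ← hr] at this
    exact this
  have hPS : ∀ n, P n → socle R • (⊤ : Submodule R (A n)) ≤
      maximalIdeal R • LinearMap.range (d n) := by
    intro n hn
    refine socle_le_smul_range hnotGor (d n) (hk n) (hS n) fun φ hφ => hn φ ?_
    rw [← hacyclic] at hφ
    ext v
    exact hφ ⟨v, rfl⟩
  have e4 : ∀ n, P n → c n = a n * r := by
    intro n hn
    apply le_antisymm (e3 n)
    have := lenN_mono (hPS n hn)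
    rw [lenN_smul_top, ← hr] at this
    exact this
  have kd : ∀ n, LinearMap.ker (d n).dualMap ≤ maximalIdeal R • ⊤ := fun n =>
    ker_dual_le hnotGor (d n) (hS n)
  have e5 : ∀ n, a n * L = κ n + ν n := by
    intro n
    have := (lenN_range_aux (d n).dualMap (kd n)).1
    rw [← hL, Module.finrank_linearMap_self] at this
    exact this
  have e6 : ∀ n, a n * q = κ n + ι n := by
    intro n
    have := (lenN_range_aux (d n).dualMap (kd n)).2
    rw [← hq, Module.finrank_linearMap_self] at this
    exact this
  have hνκ : ∀ n, LinearMap.range (d n).dualMap ≤ LinearMap.ker (d (n + 1)).dualMap := by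
    rintro n _ ⟨ψ, rfl⟩
    rw [LinearMap.mem_ker]
    ext v
    have := LinearMap.congr_fun (hcx n) v
    simp only [LinearMap.comp_apply] at this
    simp [this]
  have hPeq : ∀ n, P n ↔ LinearMap.range (d n).dualMap = LinearMap.ker (d (n + 1)).dualMap := by
    intro n
    constructor
    · intro h
      refine le_antisymm (hνκ n) fun φ hφ => ?_
      obtain ⟨g, hg⟩ := h φ hφ
      exact ⟨g, hg.symm⟩
    · intro h φ hφ
      have h1 : φ ∈ LinearMap.ker (d (n + 1)).dualMap := hφ
      rw [← h] at h1
      obtain ⟨g, hg⟩ := h1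
      exact ⟨g, hg.symm⟩
  have e7 : ∀ n, ν n ≤ κ (n + 1) := fun n => lenN_mono (hνκ n)
  have e8 : ∀ n, P n → ν n = κ (n + 1) := fun n hn => by
    have := congrArg lenN ((hPeq n).1 hn)
    exact this
  have e9 : ∀ n, P n → ι n = a (n + 1) * r := by
    intro n hn
    apply le_antisymm
    · have := lenN_mono (smul_range_le_socle h3 (d n).dualMap (range_dual_le _ (hmin n)))
      rw [lenN_smul_top, ← hr, Module.finrank_linearMap_self] at this
      exact this
    · have := lenN_mono (socle_le_smul_range_dual hnotGor (d n) (hPS n hn) (by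
        rw [(hPeq n).1 hn]
        exact socle_le_ker _ (range_dual_le _ (hmin (n + 1)))))
      rw [lenN_smul_top, ← hr, Module.finrank_linearMap_self] at this
      exact this
  have e10 : ∀ n, κ (n + 1) ≤ ν n → P n := fun n h => (hPeq n).2 (lenN_eq_of_le (hνκ n) h)
  have htwo' : ∀ n, (P n ∧ P (n + 1)) ∨ (P n ∧ P (n + 2)) ∨ (P (n + 1) ∧ P (n + 2)) := by
    intro n
    have key : ∀ i j : ℤ, i - 1 = j → dualHomologyIsZero R A d i → P j := by
      rintro i _ rfl h
      exact h
    rcases htwo (n + 1) with ⟨h, h'⟩ | ⟨h, h'⟩ | ⟨h, h'⟩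
    · exact Or.inl ⟨key _ _ (by ring) h, key _ _ (by ring) h'⟩
    · exact Or.inr (Or.inl ⟨key _ _ (by ring) h, key _ _ (by ring) h'⟩)
    · exact Or.inr (Or.inr ⟨key _ _ (by ring) h, key _ _ (by ring) h'⟩)
  clear_value a M c κ ν ι P
  intro n
  obtain ⟨p, rfl⟩ : ∃ p, n = p + 2 := ⟨n - 2, by ring⟩
  by_contra hn
  have s2 : p + 1 + 1 = p + 2 := by ring
  have s3 : p + 2 + 1 = p + 3 := by ring
  have s3' : p + 1 + 2 = p + 3 := by ring
  have s4 : p + 3 + 1 = p + 4 := by ring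
  have s4' : p + 2 + 2 = p + 4 := by ring
  have s5 : p + 4 + 1 = p + 5 := by ring
  have t1 := htwo' p
  have t2 := htwo' (p + 1)
  have t3 := htwo' (p + 2)
  rw [s2, s3'] at t2
  rw [s3, s4'] at t3
  have P0 : P p := by tauto
  have P1 : P (p + 1) := by tauto
  have P3 : P (p + 3) := by tauto
  have P4 : P (p + 4) := by tauto
  apply hn
  apply e10
  rw [s3]
  have main := arith_aux (q - r) r (a (p + 1)) (a (p + 2)) (a (p + 3)) (a (p + 4))
    (by omega) (by omega) (by omega) (by omega) (by omega) (by omega)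
  -- collect equations
  have E1 := e1 p
  have E2 := e2 p
  have E4 := e4 p P0
  have F1 := e1 (p + 1)
  have F2 := e2 (p + 1)
  have F4 := e4 (p + 1) P1
  have G1 := e1 (p + 2)
  have G2 := e2 (p + 2)
  have G3 := e3 (p + 2)
  have I1 := e1 (p + 3)
  have I2 := e2 (p + 3)
  have I4 := e4 (p + 3) P3
  have J1 := e1 (p + 4)
  have J2 := e2 (p + 4)
  have J4 := e4 (p + 4) P4
  have E5 := e5 p
  have E6 := e6 p
  have E8 := e8 p P0
  have E9 := e9 p P0
  have F5 := e5 (p + 1)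
  have F6 := e6 (p + 1)
  have F8 := e8 (p + 1) P1
  have F9 := e9 (p + 1) P1
  have G5 := e5 (p + 2)
  have G6 := e6 (p + 2)
  have G7 := e7 (p + 2)
  have I5 := e5 (p + 3)
  have I6 := e6 (p + 3)
  have I8 := e8 (p + 3) P3
  have I9 := e9 (p + 3) P3
  have J5 := e5 (p + 4)
  have J6 := e6 (p + 4)
  have J8 := e8 (p + 4) P4
  have J9 := e9 (p + 4) P4
  simp only [s2, s3, s4, s5] at E1 E2 E4 F1 F2 F4 G1 G2 G3 I1 I2 I4 J1 J2 J4 E5 E6 E8 E9 F5 F6 F8 F9 G5 G6 G7 I5 I6 I8 I9 J5 J6 J8 J9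
  subst hLq
  clear e1 e2 e3 e4 e5 e6 e7 e8 e9 e10
  zify at E1 E2 E4 F1 F2 F4 G1 G2 G3 I1 I2 I4 J1 J2 J4 E5 E6 E8 E9 F5 F6 F8 F9 G5 G6 G7 I5 I6 I8 I9 J5 J6 J8 J9 hr2 hrq ⊢
  have hr1 : ((r : ℤ) - 1) ≠ 0 := by omega
  have u1 : (a (p + 2) : ℤ) = a p := by
    refine mul_left_cancel₀ hr1 ?_
    linarith
  have u2 : (a (p + 5) : ℤ) = a (p + 3) := by
    refine mul_left_cancel₀ hr1 ?_
    linarith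
  have v1 := congrArg (fun t : ℤ => t * r) u1
  have v2 := congrArg (fun t : ℤ => t * r) u2

  have := main (by linarith) (by linarith) (by linarith) (by linarith) (by linarith)
  linarith
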